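/- arXiv:2204.03459 — 8 statements merged into one kernel-verified Lean document; each statement's English description precedes it below -/
import Mathlib

section
/- Let V be a mixed lattice vector space and let x, y ∈ V. Then s(xᵘ − yᵘ) ≤ s(x − y), where xᵘ = 0⌣x is the specific upper part. -/
/-- A mixed lattice vector space: a real vector space with two partial orders
(the initial order `le` and the specific order `sle`), each making it a partially
ordered vector space, such that the mixed upper and lower envelopes `up` and `down`
exist, `sle` implies `le`, and the specific cone is a mixed lattice cone. -/
structure MixedLattice (V : Type*) [AddCommGroup V] [Module ℝ V] where
  le : V → V → Prop
  sle : V → V → Prop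
  le_refl : ∀ x, le x x
  le_trans : ∀ {x y z}, le x y → le y z → le x z
  le_antisymm : ∀ {x y}, le x y → le y x → x = y
  sle_refl : ∀ x, sle x x
  sle_trans : ∀ {x y z}, sle x y → sle y z → sle x z
  sle_antisymm : ∀ {x y}, sle x y → sle y x → x = y
  le_add : ∀ {x y} (z : V), le x y → le (x + z) (y + z)
  le_smul : ∀ {a : ℝ}, 0 ≤ a → ∀ {x y}, le x y → le (a • x) (a • y)
  sle_add : ∀ {x y} (z : V), sle x y → sle (x + z) (y + z)
  sle_smul : ∀ {a : ℝ}, 0 ≤ a → ∀ {x y}, sle x y → sle (a • x) (a • y)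
  /-- the mixed upper envelope `x ⌣ y` -/
  up : V → V → V
  /-- the mixed lower envelope `x ⌢ y` -/
  down : V → V → V
  up_mem₁ : ∀ x y, sle x (up x y)
  up_mem₂ : ∀ x y, le y (up x y)
  up_min : ∀ x y w, sle x w → le y w → le (up x y) w
  down_mem₁ : ∀ x y, sle (down x y) x
  down_mem₂ : ∀ x y, le (down x y) y
  down_max : ∀ x y w, sle w x → le w y → le w (down x y)
  sle_imp_le : ∀ {x y}, sle x y → le x y
  up_cone : ∀ {x y}, sle 0 x → sle 0 y → sle 0 (up x y)
  down_cone : ∀ {x y}, sle 0 x → sle 0 y → sle 0 (down x y)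

namespace MixedLattice

variable {V : Type*} [AddCommGroup V] [Module ℝ V] (M : MixedLattice V)

/-- the specific upper part `xᵘ = 0 ⌣ x` -/
def supp (x : V) : V := M.up 0 x

/-- the specific lower part `xˡ = 0 ⌣ (-x)` -/
def slowp (x : V) : V := M.up 0 (-x)

/-- the upper part `ᵘx = x ⌣ 0` -/
def upp (x : V) : V := M.up x 0

/-- the lower part `ˡx = (-x) ⌣ 0` -/
def lowp (x : V) : V := M.up (-x) 0

/-- the symmetric generalized absolute value `s(x) = (1/2)((x⌣(−x)) + ((−x)⌣x))` -/
noncomputable def sabs (x : V) : V := (1 / 2 : ℝ) • (M.up x (-x) + M.up (-x) x)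

/-- the type 1 mixed-full hull `MF₁(A) = {y : x ≼ y ≤ z for some x, z ∈ A}` -/
def MF1 (A : Set V) : Set V := {y | ∃ x ∈ A, ∃ z ∈ A, M.sle x y ∧ M.le y z}

/-- the type 2 mixed-full hull `MF₂(A) = {y : x ≤ y ≼ z for some x, z ∈ A}` -/
def MF2 (A : Set V) : Set V := {y | ∃ x ∈ A, ∃ z ∈ A, M.le x y ∧ M.sle y z}

/-- `MS₁(A) = {y : −s(x) ≼ y ≤ s(x) for some x ∈ A}` -/
def MS1 (A : Set V) : Set V := {y | ∃ x ∈ A, M.sle (-M.sabs x) y ∧ M.le y (M.sabs x)}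

/-- `MS₂(A) = {y : −s(x) ≤ y ≼ s(x) for some x ∈ A}` -/
def MS2 (A : Set V) : Set V := {y | ∃ x ∈ A, M.le (-M.sabs x) y ∧ M.sle y (M.sabs x)}

/-- a set is symmetric-solid if `x ∈ A` and `s(y) ≤ s(x)` imply `y ∈ A` -/
def SymmSolid (A : Set V) : Prop := ∀ x ∈ A, ∀ y, M.le (M.sabs y) (M.sabs x) → y ∈ A

/-- a set is (≤)-full if `x, y ∈ S` and `y ≤ z ≤ x` imply `z ∈ S` -/
def LeFull (S : Set V) : Prop := ∀ x ∈ S, ∀ y ∈ S, ∀ z, M.le y z → M.le z x → z ∈ S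

/-- a set is (≼)-full if `x, y ∈ S` and `y ≼ z ≼ x` imply `z ∈ S` -/
def SleFull (S : Set V) : Prop := ∀ x ∈ S, ∀ y ∈ S, ∀ z, M.sle y z → M.sle z x → z ∈ S

/-- a linear subspace, as a set -/
def IsSubspace (S : Set V) : Prop :=
  (0 : V) ∈ S ∧ (∀ x ∈ S, ∀ y ∈ S, x + y ∈ S) ∧ ∀ (a : ℝ), ∀ x ∈ S, a • x ∈ S

/-- a mixed lattice subspace -/
def IsMLSubspace (S : Set V) : Prop :=
  IsSubspace S ∧ ∀ x ∈ S, ∀ y ∈ S, M.up x y ∈ S ∧ M.down x y ∈ S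

section Topology

variable [TopologicalSpace V]

/-- uniform continuity of a map `V → V` with respect to a vector topology -/
def UnifCont (f : V → V) : Prop :=
  ∀ W ∈ nhds (0 : V), ∃ U ∈ nhds (0 : V), ∀ x y : V, x - y ∈ U → f x - f y ∈ W

/-- uniform continuity of a map `V × V → V` with respect to a vector topology -/
def UnifCont2 (g : V → V → V) : Prop :=
  ∀ W ∈ nhds (0 : V), ∃ U ∈ nhds (0 : V),
    ∀ x x' y y' : V, x - x' ∈ U → y - y' ∈ U → g x y - g x' y' ∈ W

/-- the topology is locally mixed-full: every neighborhood of zero contains a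
type 1 mixed-full neighborhood of zero -/
def LocallyMixedFull : Prop :=
  ∀ U ∈ nhds (0 : V), ∃ W ∈ nhds (0 : V), W ⊆ U ∧ M.MF1 W = W

/-- the topology has a neighborhood base at zero of symmetric-solid sets -/
def LocallySymmSolid : Prop :=
  ∀ U ∈ nhds (0 : V), ∃ W ∈ nhds (0 : V), W ⊆ U ∧ M.SymmSolid W

/-- the topology has a neighborhood base at zero of (≤)-full sets -/
def LocallyLeFull : Prop :=
  ∀ U ∈ nhds (0 : V), ∃ W ∈ nhds (0 : V), W ⊆ U ∧ M.LeFull W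

/-- the mixed lattice operations are continuous at zero -/
def ContAtZero : Prop :=
  ContinuousAt (fun p : V × V => M.up p.1 p.2) ((0 : V), (0 : V)) ∧
  ContinuousAt (fun p : V × V => M.down p.1 p.2) ((0 : V), (0 : V))

end Topology

end MixedLattice

namespace MixedLattice

variable {V : Type*} [AddCommGroup V] [Module ℝ V] (M : MixedLattice V)

theorem add_le_add {a b c d : V} (h₁ : M.le a b) (h₂ : M.le c d) : M.le (a + c) (b + d) := by
  have h := M.le_add b h₂
  rw [add_comm c, add_comm d] at h
  exact M.le_trans (M.le_add c h₁) h

theorem sle_add_nonneg {a b : V} (ha : M.sle 0 a) (hb : M.sle 0 b) : M.sle 0 (a + b) := by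
  have h := M.sle_add b ha
  rw [zero_add] at h
  exact M.sle_trans hb h

theorem up_add_right_le (x y z : V) : M.le (M.up (x + z) (y + z)) (M.up x y + z) :=
  M.up_min _ _ _ (M.sle_add z (M.up_mem₁ x y)) (M.le_add z (M.up_mem₂ x y))

/-- The mixed upper envelope is translation-equivariant. -/
theorem up_add_right (x y z : V) : M.up (x + z) (y + z) = M.up x y + z := by
  refine M.le_antisymm (M.up_add_right_le x y z) ?_
  have h := M.le_add z (M.up_add_right_le (x + z) (y + z) (-z))
  simpa using h

theorem supp_smul_le {a : ℝ} (ha : 0 ≤ a) (x : V) : M.le (M.supp (a • x)) (a • M.supp x) := by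
  refine M.up_min _ _ _ ?_ (M.le_smul ha (M.up_mem₂ 0 x))
  simpa [supp] using M.sle_smul ha (M.up_mem₁ 0 x)

/-- The specific upper part is positively homogeneous. -/
theorem supp_smul {a : ℝ} (ha : 0 < a) (x : V) : M.supp (a • x) = a • M.supp x := by
  refine M.le_antisymm (M.supp_smul_le ha.le x) ?_
  have h := M.le_smul ha.le (M.supp_smul_le (inv_nonneg.2 ha.le) (a • x))
  simpa [smul_smul, ha.ne'] using h

theorem up_neg_self (x : V) : M.up (-x) x = (2 : ℝ) • M.supp x - x := by
  have h := M.up_add_right 0 ((2 : ℝ) • x) (-x)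
  rw [zero_add, two_smul, add_neg_cancel_right, ← two_smul ℝ] at h
  rw [h, ← supp, M.supp_smul two_pos, sub_eq_add_neg]

/-- The symmetric absolute value is the sum of the specific upper and lower parts. -/
theorem sabs_eq_supp_add_supp_neg (x : V) : M.sabs x = M.supp x + M.supp (-x) := by
  have h := M.up_neg_self (-x)
  rw [neg_neg] at h
  rw [sabs, h, M.up_neg_self]
  module

/-- The specific upper part is subadditive. -/
theorem supp_add_le (x y : V) : M.le (M.supp (x + y)) (M.supp x + M.supp y) :=
  M.up_min _ _ _ (M.sle_add_nonneg (M.up_mem₁ 0 x) (M.up_mem₁ 0 y))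
    (M.add_le_add (M.up_mem₂ 0 x) (M.up_mem₂ 0 y))

theorem supp_supp_sub_supp_le (x y : V) :
    M.le (M.supp (M.supp x - M.supp y)) (M.supp (x - y)) := by
  refine M.up_min _ _ _ (M.up_mem₁ 0 _) ?_
  have h := M.le_add (-M.supp y) (M.supp_add_le (x - y) y)
  simpa [← sub_eq_add_neg] using h

end MixedLattice

/-- In a mixed lattice vector space, `s(xᵘ − yᵘ) ≤ s(x − y)`. -/
theorem stmt_0 {V : Type*} [AddCommGroup V] [Module ℝ V] (M : MixedLattice V) (x y : V) :
    M.le (M.sabs (M.supp x - M.supp y)) (M.sabs (x - y)) := by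
  rw [M.sabs_eq_supp_add_supp_neg, M.sabs_eq_supp_add_supp_neg, neg_sub, neg_sub]
  exact M.add_le_add (M.supp_supp_sub_supp_le x y) (M.supp_supp_sub_supp_le y x)
end

section
/- Let V be a mixed lattice vector space equipped with a vector topology. Then the following are equivalent: (a) each neighborhood of zero contains a type 2 mixed-full neighborhood of zero; (b) each neighborhood of zero contains a neighborhood W of zero such that y ∈ W and 0 ≤ x ≼ y imply x ∈ W; (c) each neighborhood of zero contains a type 1 mixed-full neighborhood of zero; (d) each neighborhood of zero contains a neighborhood W of zero such that y ∈ W and 0 ≼ x ≤ y imply x ∈ W. -/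
namespace MixedLattice

variable {V : Type*} {r s : V → V → Prop}

/-- The hull `{y | x r y s z for some x, z ∈ A}` of two reflexive and transitive relations
is idempotent. -/
theorem hull_idem (hr : ∀ x, r x x) (hs : ∀ x, s x x)
    (hrt : ∀ {x y z}, r x y → r y z → r x z) (hst : ∀ {x y z}, s x y → s y z → s x z)
    (A : Set V) :
    {y | ∃ x ∈ {y | ∃ x ∈ A, ∃ z ∈ A, r x y ∧ s y z},
      ∃ z ∈ {y | ∃ x ∈ A, ∃ z ∈ A, r x y ∧ s y z}, r x y ∧ s y z} =
    {y | ∃ x ∈ A, ∃ z ∈ A, r x y ∧ s y z} := by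
  ext y
  constructor
  · rintro ⟨x, ⟨x', hx', -, -, hx'x, -⟩, z, ⟨-, -, z', hz', -, hzz'⟩, hxy, hyz⟩
    exact ⟨x', hx', z', hz', hrt hx'x hxy, hst hyz hzz'⟩
  · exact fun hy => ⟨y, hy, y, hy, hr y, hs y⟩

variable [AddCommGroup V] [TopologicalSpace V]

/-- If the neighborhoods of zero satisfying `0 r x s y ∈ W → x ∈ W` form a base, then so do the
neighborhoods of zero that are full with respect to the interchanged pair of relations. -/
theorem exists_nhds_hull_eq_of_exists_nhds_solid [IsTopologicalAddGroup V]
    (hr : ∀ x, r x x) (hs : ∀ x, s x x)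
    (hrt : ∀ {x y z}, r x y → r y z → r x z) (hst : ∀ {x y z}, s x y → s y z → s x z)
    (hra : ∀ {x y} (z : V), r x y → r (x + z) (y + z))
    (hsa : ∀ {x y} (z : V), s x y → s (x + z) (y + z))
    (h : ∀ U ∈ nhds (0 : V), ∃ W ∈ nhds (0 : V), W ⊆ U ∧
      ∀ y ∈ W, ∀ x : V, r 0 x → s x y → x ∈ W) (U : Set V) (hU : U ∈ nhds 0) :
    ∃ W ∈ nhds (0 : V), W ⊆ U ∧ {y | ∃ x ∈ W, ∃ z ∈ W, s x y ∧ r y z} = W := by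
  obtain ⟨N, hN, hNU⟩ := exists_nhds_half_neg hU
  obtain ⟨W, hW, hWN, hsolid⟩ := h N hN
  obtain ⟨A, hA, hAW⟩ := exists_nhds_half_neg hW
  refine ⟨{y | ∃ x ∈ A ∩ N, ∃ z ∈ A ∩ N, s x y ∧ r y z},
    Filter.mem_of_superset (Filter.inter_mem hA hN) fun y hy => ⟨y, hy, y, hy, hs y, hr y⟩,
    ?_, hull_idem hs hr hst hrt _⟩
  rintro y ⟨x, hx, z, hz, hxy, hyz⟩
  have hpos : r 0 (z - y) := by
    simpa [sub_eq_add_neg] using hra (-y) hyz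
  have hle : s (z - y) (z - x) := by
    have := hsa (z - y - x) hxy
    rwa [show x + (z - y - x) = z - y by abel, show y + (z - y - x) = z - x by abel] at this
  simpa using hNU z hz.2 (z - y) (hWN (hsolid _ (hAW z hz.1 x hx.1) _ hpos hle))

/-- Neighborhoods of zero that are full with respect to `r` and `s` satisfy
`0 r x s y ∈ W → x ∈ W`. -/
theorem exists_nhds_solid_of_exists_nhds_hull_eq
    (h : ∀ U ∈ nhds (0 : V), ∃ W ∈ nhds (0 : V), W ⊆ U ∧
      {y | ∃ x ∈ W, ∃ z ∈ W, r x y ∧ s y z} = W) (U : Set V) (hU : U ∈ nhds 0) :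
    ∃ W ∈ nhds (0 : V), W ⊆ U ∧ ∀ y ∈ W, ∀ x : V, r 0 x → s x y → x ∈ W := by
  obtain ⟨W, hW, hWU, hfull⟩ := h U hU
  exact ⟨W, hW, hWU, fun y hy x h0 hxy =>
    hfull.subset ⟨0, mem_of_mem_nhds hW, y, hy, h0, hxy⟩⟩

end MixedLattice

/-- equivalence of the various descriptions of locally mixed-full topologies. -/
theorem stmt_2 {V : Type*} [AddCommGroup V] [Module ℝ V] (M : MixedLattice V)
    [TopologicalSpace V] [ContinuousAdd V] [ContinuousSMul ℝ V] :
    List.TFAE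
      [ -- (a) each nbhd of zero contains a type 2 mixed-full nbhd of zero
        ∀ U ∈ nhds (0 : V), ∃ W ∈ nhds (0 : V), W ⊆ U ∧ M.MF2 W = W,
        -- (b) each nbhd of zero contains a nbhd W : y ∈ W, 0 ≤ x ≼ y ⟹ x ∈ W
        ∀ U ∈ nhds (0 : V), ∃ W ∈ nhds (0 : V), W ⊆ U ∧
          ∀ y ∈ W, ∀ x : V, M.le 0 x → M.sle x y → x ∈ W,
        -- (c) each nbhd of zero contains a type 1 mixed-full nbhd of zero
        ∀ U ∈ nhds (0 : V), ∃ W ∈ nhds (0 : V), W ⊆ U ∧ M.MF1 W = W,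
        -- (d) each nbhd of zero contains a nbhd W : y ∈ W, 0 ≼ x ≤ y ⟹ x ∈ W
        ∀ U ∈ nhds (0 : V), ∃ W ∈ nhds (0 : V), W ⊆ U ∧
          ∀ y ∈ W, ∀ x : V, M.sle 0 x → M.le x y → x ∈ W ] := by
  have : ContinuousNeg V := ContinuousNeg.of_continuousConstSMul ℝ V
  have : IsTopologicalAddGroup V := {}
  tfae_have 1 → 2 := MixedLattice.exists_nhds_solid_of_exists_nhds_hull_eq
  tfae_have 2 → 3 := MixedLattice.exists_nhds_hull_eq_of_exists_nhds_solid
    M.le_refl M.sle_refl M.le_trans M.sle_trans M.le_add M.sle_add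
  tfae_have 3 → 4 := MixedLattice.exists_nhds_solid_of_exists_nhds_hull_eq
  tfae_have 4 → 1 := MixedLattice.exists_nhds_hull_eq_of_exists_nhds_solid
    M.sle_refl M.le_refl M.sle_trans M.le_trans M.sle_add M.le_add
  tfae_finish
end

section
/- Let V be a topological mixed lattice space and let A ⊆ V be balanced and absorbing. Then MF₁(A) = −MF₂(A), and the set B = MF₁(A) + MF₂(A) is balanced, absorbing, and mixed-full in the sense that y ∈ B together with either 0 ≼ x ≤ y or 0 ≤ x ≼ y implies x ∈ B. If in addition A is convex, then MF₁(A), MF₂(A) and B are convex. -/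
namespace MixedLattice

variable {V : Type*} [AddCommGroup V] [Module ℝ V] (M : MixedLattice V)

theorem le_neg {x y : V} (h : M.le x y) : M.le (-y) (-x) := by
  simpa using M.le_add (-x + -y) h

theorem sle_neg {x y : V} (h : M.sle x y) : M.sle (-y) (-x) := by
  simpa using M.sle_add (-x + -y) h

theorem le_add_add {a b c d : V} (h : M.le a b) (h' : M.le c d) : M.le (a + c) (b + d) :=
  M.le_trans (M.le_add c h) (by simpa only [add_comm] using M.le_add b h')

theorem sle_add_add {a b c d : V} (h : M.sle a b) (h' : M.sle c d) : M.sle (a + c) (b + d) :=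
  M.sle_trans (M.sle_add c h) (by simpa only [add_comm] using M.sle_add b h')

variable {A : Set V}

theorem subset_MF1 : A ⊆ M.MF1 A := fun x hx => ⟨x, hx, x, hx, M.sle_refl x, M.le_refl x⟩

theorem subset_MF2 : A ⊆ M.MF2 A := fun x hx => ⟨x, hx, x, hx, M.le_refl x, M.sle_refl x⟩

theorem neg_mem_MF2 (hA : ∀ x ∈ A, -x ∈ A) {y : V} (hy : y ∈ M.MF1 A) : -y ∈ M.MF2 A := by
  obtain ⟨x, hx, z, hz, hxy, hyz⟩ := hy
  exact ⟨-z, hA z hz, -x, hA x hx, M.le_neg hyz, M.sle_neg hxy⟩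

theorem neg_mem_MF1 (hA : ∀ x ∈ A, -x ∈ A) {y : V} (hy : y ∈ M.MF2 A) : -y ∈ M.MF1 A := by
  obtain ⟨x, hx, z, hz, hxy, hyz⟩ := hy
  exact ⟨-z, hA z hz, -x, hA x hx, M.sle_neg hyz, M.le_neg hxy⟩

theorem smul_mem_MF1 {a : ℝ} (ha : 0 ≤ a) (hA : ∀ x ∈ A, a • x ∈ A) {y : V}
    (hy : y ∈ M.MF1 A) : a • y ∈ M.MF1 A := by
  obtain ⟨x, hx, z, hz, hxy, hyz⟩ := hy
  exact ⟨a • x, hA x hx, a • z, hA z hz, M.sle_smul ha hxy, M.le_smul ha hyz⟩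

theorem smul_mem_MF2 {a : ℝ} (ha : 0 ≤ a) (hA : ∀ x ∈ A, a • x ∈ A) {y : V}
    (hy : y ∈ M.MF2 A) : a • y ∈ M.MF2 A := by
  obtain ⟨x, hx, z, hz, hxy, hyz⟩ := hy
  exact ⟨a • x, hA x hx, a • z, hA z hz, M.le_smul ha hxy, M.sle_smul ha hyz⟩

theorem convex_MF1 (hA : Convex ℝ A) : Convex ℝ (M.MF1 A) := by
  rintro y ⟨x, hx, z, hz, hxy, hyz⟩ y' ⟨x', hx', z', hz', hxy', hyz'⟩ a b ha hb hab
  exact ⟨a • x + b • x', hA hx hx' ha hb hab, a • z + b • z', hA hz hz' ha hb hab,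
    M.sle_add_add (M.sle_smul ha hxy) (M.sle_smul hb hxy'),
    M.le_add_add (M.le_smul ha hyz) (M.le_smul hb hyz')⟩

theorem convex_MF2 (hA : Convex ℝ A) : Convex ℝ (M.MF2 A) := by
  rintro y ⟨x, hx, z, hz, hxy, hyz⟩ y' ⟨x', hx', z', hz', hxy', hyz'⟩ a b ha hb hab
  exact ⟨a • x + b • x', hA hx hx' ha hb hab, a • z + b • z', hA hz hz' ha hb hab,
    M.le_add_add (M.le_smul ha hxy) (M.le_smul hb hxy'),
    M.sle_add_add (M.sle_smul ha hyz) (M.sle_smul hb hyz')⟩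

open Pointwise

theorem balanced_MF1_add_MF2 (hA : Balanced ℝ A) : Balanced ℝ (M.MF1 A + M.MF2 A) := by
  have hneg : ∀ x ∈ A, -x ∈ A := fun x hx => hA.neg_mem_iff.mpr hx
  rintro a ha _ ⟨_, ⟨u, hu, v, hv, rfl⟩, rfl⟩
  rw [Real.norm_eq_abs] at ha
  have hsmul : ∀ x ∈ A, |a| • x ∈ A := fun x hx => hA.smul_mem (by simpa using ha) hx
  have hu' := M.smul_mem_MF1 (abs_nonneg a) hsmul hu
  have hv' := M.smul_mem_MF2 (abs_nonneg a) hsmul hv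
  rcases abs_cases a with ⟨h, -⟩ | ⟨h, -⟩ <;> rw [h] at hu' hv'
  · exact ⟨a • u, hu', a • v, hv', (smul_add a u v).symm⟩
  · refine ⟨a • v, ?_, a • u, ?_, by simp [smul_add, add_comm]⟩
    · simpa using M.neg_mem_MF1 hneg hv'
    · simpa using M.neg_mem_MF2 hneg hu'

theorem mem_MF1_add_MF2_of_sle_of_le (hA : ∀ x ∈ A, -x ∈ A) {x y : V}
    (hy : y ∈ M.MF1 A + M.MF2 A) (hx : M.sle 0 x) (hxy : M.le x y) :
    x ∈ M.MF1 A + M.MF2 A := by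
  obtain ⟨u, ⟨_, _, c, hc, _, huc⟩, v, ⟨_, _, d, hd, _, hvd⟩, rfl⟩ := hy
  refine ⟨x - d, ⟨-d, hA d hd, c, hc, ?_, ?_⟩, d, M.subset_MF2 hd, sub_add_cancel x d⟩
  · simpa [sub_eq_add_neg] using M.sle_add (-d) hx
  · simpa [sub_eq_add_neg] using
      M.le_add (-d) (M.le_trans hxy (M.le_add_add huc (M.sle_imp_le hvd)))

theorem mem_MF1_add_MF2_of_le_of_sle (hA : ∀ x ∈ A, -x ∈ A) {x y : V}
    (hy : y ∈ M.MF1 A + M.MF2 A) (hx : M.le 0 x) (hxy : M.sle x y) :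
    x ∈ M.MF1 A + M.MF2 A := by
  obtain ⟨u, hu, v, ⟨_, _, d, hd, _, hvd⟩, rfl⟩ := hy
  obtain ⟨_, _, c, hc, _, huc⟩ := id hu
  refine ⟨u, hu, x - u, ⟨-c, hA c hc, d, hd, ?_, ?_⟩, add_sub_cancel u x⟩
  · simpa [sub_eq_add_neg] using M.le_add_add hx (M.le_neg huc)
  · exact M.sle_trans (by simpa [sub_eq_add_neg] using M.sle_add (-u) hxy) hvd

end MixedLattice

open Pointwise in
/-- for a balanced absorbing set `A` in a topological mixed lattice space,
`MF₁(A) = −MF₂(A)`, and `B = MF₁(A) + MF₂(A)` is balanced, absorbing and mixed-full;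
convexity of `A` is inherited by `MF₁(A)`, `MF₂(A)` and `B`. -/
theorem stmt_3 {V : Type*} [AddCommGroup V] [Module ℝ V] (M : MixedLattice V)
    [TopologicalSpace V] [ContinuousAdd V] [ContinuousSMul ℝ V]
    (hup : Continuous fun p : V × V => M.up p.1 p.2)
    (hdown : Continuous fun p : V × V => M.down p.1 p.2)
    (A : Set V) (hbal : Balanced ℝ A) (habs : Absorbent ℝ A) :
    M.MF1 A = -(M.MF2 A) ∧
    Balanced ℝ (M.MF1 A + M.MF2 A) ∧
    Absorbent ℝ (M.MF1 A + M.MF2 A) ∧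
    (∀ y ∈ M.MF1 A + M.MF2 A, ∀ x : V,
      (M.sle 0 x ∧ M.le x y) ∨ (M.le 0 x ∧ M.sle x y) → x ∈ M.MF1 A + M.MF2 A) ∧
    (Convex ℝ A →
      Convex ℝ (M.MF1 A) ∧ Convex ℝ (M.MF2 A) ∧ Convex ℝ (M.MF1 A + M.MF2 A)) := by
  have hneg : ∀ x ∈ A, -x ∈ A := fun x hx => hbal.neg_mem_iff.mpr hx
  have h0 : (0 : V) ∈ A := habs.zero_mem
  refine ⟨?_, M.balanced_MF1_add_MF2 hbal, ?_, ?_, fun hA =>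
    ⟨M.convex_MF1 hA, M.convex_MF2 hA, (M.convex_MF1 hA).add (M.convex_MF2 hA)⟩⟩
  · ext y
    exact ⟨fun hy => M.neg_mem_MF2 hneg hy, fun hy => by simpa using M.neg_mem_MF1 hneg hy⟩
  · exact habs.mono fun x hx => ⟨x, M.subset_MF1 hx, 0, M.subset_MF2 h0, add_zero x⟩
  · rintro y hy x (⟨hx, hxy⟩ | ⟨hx, hxy⟩)
    · exact M.mem_MF1_add_MF2_of_sle_of_le hneg hy hx hxy
    · exact M.mem_MF1_add_MF2_of_le_of_sle hneg hy hx hxy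
end

section
/- Let V be a topological mixed lattice space whose topology τ is locally mixed-full. Then every neighborhood of zero contains a balanced absorbing neighborhood B of zero that is mixed-full, i.e., y ∈ B together with either 0 ≼ x ≤ y or 0 ≤ x ≼ y implies x ∈ B. If in addition τ is locally convex, then every neighborhood of zero contains a convex, balanced and absorbing neighborhood of zero with the same mixed-full property. -/
namespace MixedLattice

variable {V : Type*} [AddCommGroup V] [Module ℝ V] (M : MixedLattice V)

/-- the decreasing hull of a set with respect to the initial order -/
def leHull (A : Set V) : Set V := {v | ∃ a ∈ A, M.le v a}

/-- The sums `u + c - d` with `u ∈ A` and `c`, `d` in the specific cone, where `c`, `d`, `c + u`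
and `d - u` all lie below elements of `A`. -/
def mixedFullHull (A : Set V) : Set V :=
  {y | ∃ u ∈ A, ∃ c d, M.sle 0 c ∧ M.sle 0 d ∧ c ∈ M.leHull A ∧ d ∈ M.leHull A ∧
    c + u ∈ M.leHull A ∧ d - u ∈ M.leHull A ∧ y = u + c - d}

variable {M}

theorem add_le_add_s4 {x x' y y' : V} (h : M.le x x') (h' : M.le y y') :
    M.le (x + y) (x' + y') := by
  have h₂ := M.le_add x' h'
  rw [add_comm y, add_comm y'] at h₂
  exact M.le_trans (M.le_add y h) h₂

theorem sle_zero_add {x y : V} (hx : M.sle 0 x) (hy : M.sle 0 y) : M.sle 0 (x + y) := by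
  have h := M.sle_add y hx
  rw [zero_add] at h
  exact M.sle_trans hy h

theorem sle_zero_smul {a : ℝ} (ha : 0 ≤ a) {x : V} (hx : M.sle 0 x) : M.sle 0 (a • x) := by
  simpa using M.sle_smul ha hx

theorem sle_zero_sub {x y : V} (h : M.sle x y) : M.sle 0 (y - x) := by
  simpa [sub_eq_add_neg] using M.sle_add (-x) h

variable {A : Set V}

theorem subset_leHull : A ⊆ M.leHull A := fun a ha => ⟨a, ha, M.le_refl a⟩

theorem leHull_of_le {x y : V} (h : M.le x y) (hy : y ∈ M.leHull A) : x ∈ M.leHull A := by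
  obtain ⟨a, ha, hya⟩ := hy
  exact ⟨a, ha, M.le_trans h hya⟩

theorem smul_mem_leHull (hA : Balanced ℝ A) {a : ℝ} (h₀ : 0 ≤ a) (h₁ : a ≤ 1) {x : V}
    (hx : x ∈ M.leHull A) : a • x ∈ M.leHull A := by
  obtain ⟨b, hb, hxb⟩ := hx
  exact ⟨a • b, hA.smul_mem (by rwa [Real.norm_of_nonneg h₀]) hb, M.le_smul h₀ hxb⟩

theorem convex_leHull (hA : Convex ℝ A) : Convex ℝ (M.leHull A) := by
  rintro x ⟨a, ha, hxa⟩ y ⟨b, hb, hyb⟩ s t hs ht hst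
  exact ⟨s • a + t • b, hA ha hb hs ht hst, add_le_add_s4 (M.le_smul hs hxa) (M.le_smul ht hyb)⟩

theorem subset_mixedFullHull (hA : Balanced ℝ A) : A ⊆ M.mixedFullHull A := by
  intro u hu
  have h0 : (0 : V) ∈ M.leHull A := subset_leHull (hA.zero_mem ⟨u, hu⟩)
  have hneg : -u ∈ A := hA.neg_mem_iff.2 hu
  exact ⟨u, hu, 0, 0, M.sle_refl 0, M.sle_refl 0, h0, h0, by simpa using subset_leHull hu,
    by simpa using subset_leHull hneg, by simp⟩

theorem neg_mem_mixedFullHull (hA : Balanced ℝ A) {y : V} (hy : y ∈ M.mixedFullHull A) :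
    -y ∈ M.mixedFullHull A := by
  obtain ⟨u, hu, c, d, hc, hd, hcA, hdA, hcu, hdu, rfl⟩ := hy
  exact ⟨-u, hA.neg_mem_iff.2 hu, d, c, hd, hc, hdA, hcA, by rwa [← sub_eq_add_neg],
    by rwa [sub_neg_eq_add], by abel⟩

theorem smul_mem_mixedFullHull (hA : Balanced ℝ A) {a : ℝ} (h₀ : 0 ≤ a) (h₁ : a ≤ 1) {y : V}
    (hy : y ∈ M.mixedFullHull A) : a • y ∈ M.mixedFullHull A := by
  obtain ⟨u, hu, c, d, hc, hd, hcA, hdA, hcu, hdu, rfl⟩ := hy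
  refine ⟨a • u, hA.smul_mem (by rwa [Real.norm_of_nonneg h₀]) hu, a • c, a • d,
    sle_zero_smul h₀ hc, sle_zero_smul h₀ hd, smul_mem_leHull hA h₀ h₁ hcA,
    smul_mem_leHull hA h₀ h₁ hdA, ?_, ?_, by module⟩
  · rw [← smul_add]
    exact smul_mem_leHull hA h₀ h₁ hcu
  · rw [← smul_sub]
    exact smul_mem_leHull hA h₀ h₁ hdu

theorem balanced_mixedFullHull (hA : Balanced ℝ A) : Balanced ℝ (M.mixedFullHull A) := by
  rw [balanced_iff_smul_mem]
  intro a ha y hy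
  rw [Real.norm_eq_abs, abs_le] at ha
  rcases le_total 0 a with h | h
  · exact smul_mem_mixedFullHull hA h ha.2 hy
  · have := neg_mem_mixedFullHull hA (smul_mem_mixedFullHull hA (neg_nonneg.2 h)
      (neg_le.1 ha.1) hy)
    simpa using this

theorem convex_mixedFullHull (hA : Convex ℝ A) : Convex ℝ (M.mixedFullHull A) := by
  have hD := convex_leHull (M := M) hA
  rintro _ ⟨u, hu, c, d, hc, hd, hcA, hdA, hcu, hdu, rfl⟩
    _ ⟨u', hu', c', d', hc', hd', hcA', hdA', hcu', hdu', rfl⟩ s t hs ht hst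
  refine ⟨s • u + t • u', hA hu hu' hs ht hst, s • c + t • c', s • d + t • d',
    sle_zero_add (sle_zero_smul hs hc) (sle_zero_smul ht hc'),
    sle_zero_add (sle_zero_smul hs hd) (sle_zero_smul ht hd'),
    hD hcA hcA' hs ht hst, hD hdA hdA' hs ht hst, ?_, ?_, by module⟩
  · convert hD hcu hcu' hs ht hst using 1
    module
  · convert hD hdu hdu' hs ht hst using 1
    module

theorem mem_mixedFullHull_of_sle_of_le (hA : Balanced ℝ A) {x y : V}
    (hy : y ∈ M.mixedFullHull A) (hx : M.sle 0 x) (hxy : M.le x y) :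
    x ∈ M.mixedFullHull A := by
  obtain ⟨u, hu, c, d, hc, hd, hcA, hdA, hcu, hdu, rfl⟩ := hy
  have h0A : (0 : V) ∈ A := hA.zero_mem ⟨u, hu⟩
  have h0 : (0 : V) ∈ M.leHull A := subset_leHull h0A
  have hle : M.le (u + c - d) (c + u) := by
    have := M.le_add (u + c - d) (M.sle_imp_le hd)
    convert this using 1 <;> abel
  have hxA : x ∈ M.leHull A := leHull_of_le (M.le_trans hxy hle) hcu
  exact ⟨0, h0A, x, 0, hx, M.sle_refl 0, hxA, h0, by simpa using hxA, by simpa using h0, by simp⟩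

theorem mem_mixedFullHull_of_le_of_sle {x y : V}
    (hy : y ∈ M.mixedFullHull A) (hx : M.le 0 x) (hxy : M.sle x y) :
    x ∈ M.mixedFullHull A := by
  obtain ⟨u, hu, c, d, hc, hd, hcA, hdA, hcu, hdu, rfl⟩ := hy
  refine ⟨u, hu, c, d + (u + c - d - x), hc, sle_zero_add hd (sle_zero_sub hxy), hcA, ?_, hcu, ?_,
    by abel⟩
  · refine leHull_of_le ?_ hcu
    convert M.le_add (c + u - x) hx using 1 <;> abel
  · refine leHull_of_le ?_ hcA
    convert M.le_add (c - x) hx using 1 <;> abel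

theorem mem_of_sle_zero_of_mem_leHull {W : Set V} (hW : M.MF1 W = W) (h0 : (0 : V) ∈ W)
    (hAW : A ⊆ W) {c : V} (hc : M.sle 0 c) (hcA : c ∈ M.leHull A) : c ∈ W := by
  obtain ⟨a, ha, hca⟩ := hcA
  rw [← hW]
  exact ⟨0, h0, a, hAW ha, hc, hca⟩

/-- In a locally mixed-full vector topology, the mixed-full hulls of all small enough sets lie in
a given neighborhood of zero. -/
theorem exists_nhds_mixedFullHull_subset [TopologicalSpace V] [ContinuousAdd V]
    [ContinuousSMul ℝ V] (hfull : M.LocallyMixedFull) {U : Set V} (hU : U ∈ nhds (0 : V)) :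
    ∃ W ∈ nhds (0 : V), ∀ A ⊆ W, M.mixedFullHull A ⊆ U := by
  have hcont : Continuous fun p : V × V × V => p.1 + p.2.1 + (-1 : ℝ) • p.2.2 := by fun_prop
  have hpre := hcont.continuousAt.preimage_mem_nhds (x := (0, 0, 0)) (t := U) (by simpa using hU)
  rw [nhds_prod_eq, nhds_prod_eq] at hpre
  obtain ⟨N₁, hN₁, N', hN', hN⟩ := Filter.mem_prod_iff.1 hpre
  obtain ⟨N₂, hN₂, N₃, hN₃, hN₂₃⟩ := Filter.mem_prod_iff.1 hN'
  obtain ⟨W, hW, hWN, hWfull⟩ :=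
    hfull _ (Filter.inter_mem hN₁ (Filter.inter_mem hN₂ hN₃))
  refine ⟨W, hW, fun A hAW => ?_⟩
  rintro _ ⟨u, hu, c, d, hc, hd, hcA, hdA, -, -, rfl⟩
  have h0 := mem_of_mem_nhds hW
  have hcW := mem_of_sle_zero_of_mem_leHull hWfull h0 hAW hc hcA
  have hdW := mem_of_sle_zero_of_mem_leHull hWfull h0 hAW hd hdA
  have hmem : (u, c, d) ∈ N₁ ×ˢ N' :=
    ⟨(hWN (hAW hu)).1, hN₂₃ ⟨(hWN hcW).2.1, (hWN hdW).2.2⟩⟩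
  simpa [sub_eq_add_neg] using hN hmem

theorem mem_mixedFullHull_of_mixed (hA : Balanced ℝ A) :
    ∀ y ∈ M.mixedFullHull A, ∀ x : V,
      (M.sle 0 x ∧ M.le x y) ∨ (M.le 0 x ∧ M.sle x y) → x ∈ M.mixedFullHull A := by
  rintro y hy x (⟨hx, hxy⟩ | ⟨hx, hxy⟩)
  · exact mem_mixedFullHull_of_sle_of_le hA hy hx hxy
  · exact mem_mixedFullHull_of_le_of_sle hy hx hxy

end MixedLattice

/-- in a locally mixed-full topological mixed lattice space, every
neighborhood of zero contains a balanced absorbing mixed-full neighborhood of zero;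
in the locally convex case, this neighborhood can also be taken convex. -/
theorem stmt_4 {V : Type*} [AddCommGroup V] [Module ℝ V] (M : MixedLattice V)
    [TopologicalSpace V] [ContinuousAdd V] [ContinuousSMul ℝ V]
    (hup : Continuous fun p : V × V => M.up p.1 p.2)
    (hdown : Continuous fun p : V × V => M.down p.1 p.2)
    (hfull : M.LocallyMixedFull) :
    (∀ U ∈ nhds (0 : V), ∃ B ∈ nhds (0 : V), B ⊆ U ∧
      Balanced ℝ B ∧ Absorbent ℝ B ∧
      ∀ y ∈ B, ∀ x : V, (M.sle 0 x ∧ M.le x y) ∨ (M.le 0 x ∧ M.sle x y) → x ∈ B) ∧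
    (LocallyConvexSpace ℝ V →
      ∀ U ∈ nhds (0 : V), ∃ B ∈ nhds (0 : V), B ⊆ U ∧
        Convex ℝ B ∧ Balanced ℝ B ∧ Absorbent ℝ B ∧
        ∀ y ∈ B, ∀ x : V, (M.sle 0 x ∧ M.le x y) ∨ (M.le 0 x ∧ M.sle x y) → x ∈ B) := by
  refine ⟨fun U hU => ?_, fun _ U hU => ?_⟩
  · obtain ⟨W, hW, hWU⟩ := MixedLattice.exists_nhds_mixedFullHull_subset hfull hU
    obtain ⟨A, ⟨hA, hbal⟩, hAW⟩ := (nhds_basis_balanced ℝ V).mem_iff.1 hW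
    have hB := Filter.mem_of_superset hA (MixedLattice.subset_mixedFullHull (M := M) hbal)
    exact ⟨M.mixedFullHull A, hB, hWU A hAW, MixedLattice.balanced_mixedFullHull hbal,
      absorbent_nhds_zero hB, MixedLattice.mem_mixedFullHull_of_mixed hbal⟩
  · obtain ⟨W, hW, hWU⟩ := MixedLattice.exists_nhds_mixedFullHull_subset hfull hU
    obtain ⟨A, ⟨hA, hbal, hconv⟩, hAW⟩ := (nhds_hasBasis_absConvex ℝ V).mem_iff.1 hW
    have hB := Filter.mem_of_superset hA (MixedLattice.subset_mixedFullHull (M := M) hbal)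
    exact ⟨M.mixedFullHull A, hB, hWU A hAW, MixedLattice.convex_mixedFullHull hconv,
      MixedLattice.balanced_mixedFullHull hbal, absorbent_nhds_zero hB,
      MixedLattice.mem_mixedFullHull_of_mixed hbal⟩
end

section
/- Let V be a topological mixed lattice space with vector topology τ. Then the positive cones V_p = {x ∈ V : x ≥ 0} and V_sp = {x ∈ V : x ≽ 0} are both closed if and only if τ is Hausdorff. -/
namespace MixedLattice

variable {V : Type*} [AddCommGroup V] [Module ℝ V] (M : MixedLattice V)

theorem up_zero_right_eq_self_iff {x : V} : M.up x 0 = x ↔ M.le 0 x :=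
  ⟨fun h => h ▸ M.up_mem₂ x 0, fun h =>
    M.le_antisymm (M.up_min x 0 x (M.sle_refl x) h) (M.sle_imp_le (M.up_mem₁ x 0))⟩

theorem up_zero_left_eq_self_iff {x : V} : M.up 0 x = x ↔ M.sle 0 x :=
  ⟨fun h => h ▸ M.up_mem₁ 0 x, fun h =>
    M.le_antisymm (M.up_min 0 x x h (M.le_refl x)) (M.up_mem₂ 0 x)⟩

theorem eq_zero_iff_le_zero_neg {x : V} : x = 0 ↔ M.le 0 x ∧ M.le 0 (-x) := by
  refine ⟨fun h => ?_, fun ⟨h, h'⟩ => M.le_antisymm ?_ h⟩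
  · simp [h, M.le_refl]
  · simpa using M.le_add x h'

end MixedLattice

/-- in a topological mixed lattice space, both positive cones are closed
if and only if the topology is Hausdorff. -/
theorem stmt_9 {V : Type*} [AddCommGroup V] [Module ℝ V] (M : MixedLattice V)
    [TopologicalSpace V] [ContinuousAdd V] [ContinuousSMul ℝ V]
    (hup : Continuous fun p : V × V => M.up p.1 p.2)
    (hdown : Continuous fun p : V × V => M.down p.1 p.2) :
    (IsClosed {x : V | M.le 0 x} ∧ IsClosed {x : V | M.sle 0 x}) ↔ T2Space V := by
  have : IsTopologicalAddGroup V :=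
    { continuous_neg := by simpa using continuous_const_smul (T := V) (-1 : ℝ) }
  constructor
  · rintro ⟨hp, -⟩
    have h0 : IsClosed ({0} : Set V) := by
      convert hp.inter (hp.preimage continuous_neg) using 1
      ext x
      exact M.eq_zero_iff_le_zero_neg
    have := IsTopologicalAddGroup.t1Space V h0
    infer_instance
  · intro _
    simp only [← M.up_zero_right_eq_self_iff, ← M.up_zero_left_eq_self_iff]
    exact ⟨isClosed_eq (hup.comp (continuous_id.prodMk continuous_const)) continuous_id,
      isClosed_eq (hup.comp (continuous_const.prodMk continuous_id)) continuous_id⟩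
end

section
/- Let V be a topological mixed lattice space whose topology is Hausdorff. If (xₙ) is a sequence in V with xₙ ≤ xₘ whenever n ≤ m and xₙ converges to x in the topology, then x is the least upper bound of {xₙ} with respect to ≤. Likewise, if xₙ ≼ xₘ whenever n ≤ m and xₙ converges to x, then x is the least upper bound of {xₙ} with respect to ≼. -/
namespace MixedLattice

variable {V : Type*} [AddCommGroup V] [Module ℝ V] (M : MixedLattice V)

theorem le_iff_up_eq {x y : V} : M.le x y ↔ M.up y x = y :=
  ⟨fun h => M.le_antisymm (M.up_min y x y (M.sle_refl y) h) (M.sle_imp_le (M.up_mem₁ y x)),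
    fun h => by simpa only [h] using M.up_mem₂ y x⟩

theorem sle_iff_up_eq {x y : V} : M.sle x y ↔ M.up x y = y :=
  ⟨fun h => M.le_antisymm (M.up_min x y y h (M.le_refl y)) (M.up_mem₂ x y),
    fun h => by simpa only [h] using M.up_mem₁ x y⟩

variable [TopologicalSpace V] [T2Space V]

theorem isClosed_le (hup : Continuous fun p : V × V => M.up p.1 p.2) :
    IsClosed {p : V × V | M.le p.1 p.2} := by
  simp only [M.le_iff_up_eq]
  exact isClosed_eq (hup.comp continuous_swap) continuous_snd

theorem isClosed_sle (hup : Continuous fun p : V × V => M.up p.1 p.2) :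
    IsClosed {p : V × V | M.sle p.1 p.2} := by
  simp only [M.sle_iff_up_eq]
  exact isClosed_eq hup continuous_snd

end MixedLattice

/-- For a relation with closed graph, the limit of a monotone sequence is its least upper bound. -/
theorem isLeast_upperBound_of_tendsto_of_isClosed {V : Type*} [TopologicalSpace V]
    {r : V → V → Prop} (hr : IsClosed {p : V × V | r p.1 p.2}) {x : ℕ → V} {l : V}
    (hx : ∀ n m : ℕ, n ≤ m → r (x n) (x m)) (hl : Filter.Tendsto x Filter.atTop (nhds l)) :
    (∀ n, r (x n) l) ∧ ∀ y : V, (∀ n, r (x n) y) → r l y :=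
  ⟨fun n => hr.mem_of_tendsto (tendsto_const_nhds.prodMk_nhds hl)
      ((Filter.eventually_ge_atTop n).mono (hx n)),
    fun _ hy => hr.mem_of_tendsto (hl.prodMk_nhds tendsto_const_nhds) (Filter.Eventually.of_forall hy)⟩

/-- in a Hausdorff topological mixed lattice space, an increasing
(with respect to either order) convergent sequence converges to its least upper
bound with respect to that order. -/
theorem stmt_10 {V : Type*} [AddCommGroup V] [Module ℝ V] (M : MixedLattice V)
    [TopologicalSpace V] [ContinuousAdd V] [ContinuousSMul ℝ V]
    (hup : Continuous fun p : V × V => M.up p.1 p.2)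
    (hdown : Continuous fun p : V × V => M.down p.1 p.2)
    [T2Space V] :
    (∀ (x : ℕ → V) (l : V), (∀ n m : ℕ, n ≤ m → M.le (x n) (x m)) →
      Filter.Tendsto x Filter.atTop (nhds l) →
      (∀ n, M.le (x n) l) ∧ ∀ y : V, (∀ n, M.le (x n) y) → M.le l y) ∧
    (∀ (x : ℕ → V) (l : V), (∀ n m : ℕ, n ≤ m → M.sle (x n) (x m)) →
      Filter.Tendsto x Filter.atTop (nhds l) →
      (∀ n, M.sle (x n) l) ∧ ∀ y : V, (∀ n, M.sle (x n) y) → M.sle l y) := by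
  exact ⟨fun _ _ => isLeast_upperBound_of_tendsto_of_isClosed (M.isClosed_le hup),
    fun _ _ => isLeast_upperBound_of_tendsto_of_isClosed (M.isClosed_sle hup)⟩
end

section
/- Let V be a topological mixed lattice space. If S is a mixed lattice subspace of V then the topological closure of S is a mixed lattice subspace. Moreover, the closure of a quasi-ideal of V is a quasi-ideal, and the closure of a specific ideal of V is a specific ideal. -/
namespace MixedLattice

variable {V : Type*} [AddCommGroup V] [Module ℝ V] {M : MixedLattice V} {S : Set V}

theorem IsSubspace.add_neg_mem (h : IsSubspace S) {x y : V} (hx : x ∈ S) (hy : y ∈ S) :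
    x + -y ∈ S := by
  simpa using h.2.1 x hx _ (h.2.2 (-1) y hy)

theorem down_eq_left {y z : V} (h : M.le y z) : M.down y z = y :=
  M.le_antisymm (M.sle_imp_le (M.down_mem₁ y z)) (M.down_max y z y (M.sle_refl y) h)

theorem down_eq_right {y z : V} (h : M.sle y z) : M.down z y = y :=
  M.le_antisymm (M.down_mem₂ z y) (M.down_max z y y h (M.le_refl y))

theorem up_eq_right {y z : V} (h : M.sle y z) : M.up y z = z :=
  M.le_antisymm (M.up_min y z z h (M.le_refl z)) (M.up_mem₂ y z)

variable [TopologicalSpace V]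

theorem IsSubspace.closure [ContinuousAdd V] [ContinuousSMul ℝ V] (h : IsSubspace S) :
    IsSubspace (closure S) :=
  ⟨subset_closure h.1,
    fun _ hx _ hy => map_mem_closure₂ continuous_add hx hy h.2.1,
    fun a _ hx => map_mem_closure (continuous_const_smul a) hx (h.2.2 a)⟩

theorem IsMLSubspace.closure [ContinuousAdd V] [ContinuousSMul ℝ V]
    (hup : Continuous fun p : V × V => M.up p.1 p.2)
    (hdown : Continuous fun p : V × V => M.down p.1 p.2)
    (h : M.IsMLSubspace S) : M.IsMLSubspace (closure S) :=
  ⟨h.1.closure, fun _ hx _ hy =>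
    ⟨map_mem_closure₂ hup hx hy fun a ha b hb => (h.2 a ha b hb).1,
      map_mem_closure₂ hdown hx hy fun a ha b hb => (h.2 a ha b hb).2⟩⟩

/-- If `0 ≼ y ≤ z` with `z` in the closure of a quasi-ideal, then `y` is a limit of the
elements `y ⌢ (0 ⌣ w)` of the quasi-ideal, as `w` tends to `z`. -/
theorem mem_closure_of_nonneg_of_le
    (hup : Continuous fun p : V × V => M.up p.1 p.2)
    (hdown : Continuous fun p : V × V => M.down p.1 p.2)
    (h : M.IsMLSubspace S) (hfull : M.MF1 S ⊆ S) {y z : V} (hz : z ∈ closure S)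
    (hy : M.sle 0 y) (hyz : M.le y z) : y ∈ closure S := by
  have hcont : Continuous fun w => M.down y (M.up 0 w) :=
    hdown.comp (continuous_const.prodMk (hup.comp (continuous_const.prodMk continuous_id)))
  have hmem := map_mem_closure hcont hz fun w hw => hfull
    ⟨0, h.1.1, M.up 0 w, (h.2 0 h.1.1 w hw).1,
      M.down_cone hy (M.up_mem₁ 0 w), M.down_mem₂ y (M.up 0 w)⟩
  rwa [down_eq_left (M.le_trans hyz (M.up_mem₂ 0 z))] at hmem

/-- If `0 ≼ y ≼ z` with `z` in the closure of a specific ideal, then `y` is a limit of the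
elements `(0 ⌣ w) ⌢ y` of the specific ideal, as `w` tends to `z`. -/
theorem mem_closure_of_nonneg_of_sle
    (hup : Continuous fun p : V × V => M.up p.1 p.2)
    (hdown : Continuous fun p : V × V => M.down p.1 p.2)
    (h : M.IsMLSubspace S) (hfull : M.SleFull S) {y z : V} (hz : z ∈ closure S)
    (hy : M.sle 0 y) (hyz : M.sle y z) : y ∈ closure S := by
  have hcont : Continuous fun w => M.down (M.up 0 w) y :=
    hdown.comp ((hup.comp (continuous_const.prodMk continuous_id)).prodMk continuous_const)
  have hmem := map_mem_closure hcont hz fun w hw =>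
    hfull (M.up 0 w) (h.2 0 h.1.1 w hw).1 0 h.1.1 _
      (M.down_cone (M.up_mem₁ 0 w) hy) (M.down_mem₁ (M.up 0 w) y)
  rwa [up_eq_right (M.sle_trans hy hyz), down_eq_right hyz] at hmem

end MixedLattice

/-- the closure of a mixed lattice subspace is a mixed lattice subspace;
the closure of a quasi-ideal is a quasi-ideal; the closure of a specific ideal is a
specific ideal. -/
theorem stmt_11 {V : Type*} [AddCommGroup V] [Module ℝ V] (M : MixedLattice V)
    [TopologicalSpace V] [ContinuousAdd V] [ContinuousSMul ℝ V]
    (hup : Continuous fun p : V × V => M.up p.1 p.2)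
    (hdown : Continuous fun p : V × V => M.down p.1 p.2)
    (S : Set V) :
    (M.IsMLSubspace S → M.IsMLSubspace (closure S)) ∧
    (M.IsMLSubspace S ∧ M.MF1 S ⊆ S →
      M.IsMLSubspace (closure S) ∧ M.MF1 (closure S) ⊆ closure S) ∧
    (M.IsMLSubspace S ∧ M.SleFull S →
      M.IsMLSubspace (closure S) ∧ M.SleFull (closure S)) := by
  refine ⟨fun h => h.closure hup hdown, fun ⟨h, hfull⟩ => ⟨h.closure hup hdown, ?_⟩,
    fun ⟨h, hfull⟩ => ⟨h.closure hup hdown, ?_⟩⟩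
  · rintro y ⟨x, hx, z, hz, hxy, hyz⟩
    have hmem := MixedLattice.mem_closure_of_nonneg_of_le hup hdown h hfull
      (h.1.closure.add_neg_mem hz hx) (by simpa using M.sle_add (-x) hxy) (M.le_add (-x) hyz)
    simpa using h.1.closure.2.1 _ hmem x hx
  · intro z hz x hx y hxy hyz
    have hmem := MixedLattice.mem_closure_of_nonneg_of_sle hup hdown h hfull
      (h.1.closure.add_neg_mem hz hx) (by simpa using M.sle_add (-x) hxy) (M.sle_add (-x) hyz)
    simpa using h.1.closure.2.1 _ hmem x hx
end

section
/- Let V be a mixed lattice vector space. If p is a mixed-monotone seminorm on V, then q defined by q(x) = p(s(x)) is a mixed lattice seminorm on V. Moreover, if p is a mixed-monotone norm, then q is a mixed lattice norm. -/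
namespace MixedLattice

variable {V : Type*} [AddCommGroup V] [Module ℝ V] (M : MixedLattice V)

theorem up_add_le (x x' y y' : V) : M.le (M.up (x + x') (y + y')) (M.up x y + M.up x' y') :=
  M.up_min _ _ _ (M.sle_add_add (M.up_mem₁ x y) (M.up_mem₁ x' y'))
    (M.le_add_add (M.up_mem₂ x y) (M.up_mem₂ x' y'))

theorem up_smul_le {a : ℝ} (ha : 0 ≤ a) (x y : V) :
    M.le (M.up (a • x) (a • y)) (a • M.up x y) :=
  M.up_min _ _ _ (M.sle_smul ha (M.up_mem₁ x y)) (M.le_smul ha (M.up_mem₂ x y))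

theorem up_self (x : V) : M.up x x = x :=
  M.le_antisymm (M.up_min _ _ _ (M.sle_refl x) (M.le_refl x)) (M.up_mem₂ x x)

theorem up_smul {a : ℝ} (ha : 0 ≤ a) (x y : V) : M.up (a • x) (a • y) = a • M.up x y := by
  rcases ha.eq_or_lt with rfl | hpos
  · simp only [zero_smul, up_self]
  · refine M.le_antisymm (M.up_smul_le ha x y) ?_
    have h := M.le_smul ha (M.up_smul_le (inv_nonneg.2 ha) (a • x) (a • y))
    simpa only [inv_smul_smul₀ hpos.ne', smul_inv_smul₀ hpos.ne'] using h

theorem sabs_neg (x : V) : M.sabs (-x) = M.sabs x := by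
  simp only [sabs, neg_neg, add_comm]

theorem sabs_smul_of_nonneg {a : ℝ} (ha : 0 ≤ a) (x : V) : M.sabs (a • x) = a • M.sabs x := by
  simp only [sabs, ← smul_neg, M.up_smul ha, ← smul_add, smul_comm a (1 / 2 : ℝ)]

theorem sabs_smul (a : ℝ) (x : V) : M.sabs (a • x) = |a| • M.sabs x := by
  rw [← M.sabs_smul_of_nonneg (abs_nonneg a)]
  rcases abs_choice a with h | h <;> simp only [h, neg_smul, sabs_neg]

theorem sabs_add_le (x y : V) : M.le (M.sabs (x + y)) (M.sabs x + M.sabs y) := by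
  have h := M.le_smul (a := 1 / 2) (by norm_num)
    (M.le_add_add (M.up_add_le x y (-x) (-y)) (M.up_add_le (-x) (-y) x y))
  simpa only [sabs, neg_add, ← smul_add, add_add_add_comm] using h

theorem zero_sle_sabs (x : V) : M.sle 0 (M.sabs x) := by
  have h := M.sle_smul (a := 1 / 2) (by norm_num)
    (M.sle_add_add (M.up_mem₁ x (-x)) (M.up_mem₁ (-x) x))
  simpa only [add_neg_cancel, smul_zero, sabs] using h

theorem eq_zero_of_sabs_eq_zero {x : V} (hx : M.sabs x = 0) : x = 0 := by
  have hsum : M.up x (-x) + M.up (-x) x = 0 :=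
    (smul_eq_zero.1 hx).resolve_left (by norm_num)
  have hle : M.le (M.up (-x) x) x := by
    have h := M.le_add (x + M.up (-x) x) (M.up_mem₂ x (-x))
    rwa [neg_add_cancel_left, add_left_comm, hsum, add_zero] at h
  have hv : M.up (-x) x = x := M.le_antisymm hle (M.up_mem₂ (-x) x)
  have hu : M.up x (-x) = -x := by rwa [hv, add_eq_zero_iff_eq_neg] at hsum
  have h₁ := M.up_mem₁ x (-x)
  have h₂ := M.up_mem₁ (-x) x
  rw [hu] at h₁
  rw [hv] at h₂
  have h : (2 : ℝ) • x = 0 := by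
    rw [two_smul, add_eq_zero_iff_eq_neg]
    exact M.sle_antisymm h₁ h₂
  exact (smul_eq_zero.1 h).resolve_left two_ne_zero

end MixedLattice

/-- if `p` is a mixed-monotone seminorm then `q(x) = p(s(x))` is a
mixed lattice seminorm; if moreover `p` is a norm, then `q` is a mixed lattice norm. -/
theorem stmt_14 {V : Type*} [AddCommGroup V] [Module ℝ V] (M : MixedLattice V)
    (p : Seminorm ℝ V) (hp : ∀ x y : V, M.sle 0 x → M.le x y → p x ≤ p y) :
    (∀ (a : ℝ) (x : V), p (M.sabs (a • x)) = |a| * p (M.sabs x)) ∧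
    (∀ x y : V, p (M.sabs (x + y)) ≤ p (M.sabs x) + p (M.sabs y)) ∧
    (∀ x y : V, M.le (M.sabs x) (M.sabs y) → p (M.sabs x) ≤ p (M.sabs y)) ∧
    ((∀ x : V, p x = 0 → x = 0) → ∀ x : V, p (M.sabs x) = 0 → x = 0) := by
  refine ⟨fun a x => ?_, fun x y => ?_, fun x y h => hp _ _ (M.zero_sle_sabs x) h,
    fun hnorm x hx => M.eq_zero_of_sabs_eq_zero (hnorm _ hx)⟩
  · rw [M.sabs_smul, map_smul_eq_mul, Real.norm_eq_abs, abs_abs]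
  · exact (hp _ _ (M.zero_sle_sabs _) (M.sabs_add_le x y)).trans (map_add_le_add p _ _)
end
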